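/- arXiv:2108.05408 — 3 statements merged into one kernel-verified Lean document; each statement's English description precedes it below -/
import Mathlib

section
/- Let Γ be a discrete subgroup of SL(2,ℝ) acting on the upper half-plane ℍ by Möbius transformations. Suppose the orbit Γ·i is a bounded subset of ℂ and the limit set L(Γ) contains at least 3 points (Γ is non-elementary). Then the Poincaré exponent of Γ is bounded above by the upper box dimension of the limit set: δ(Γ) ≤ 2 − liminf_{r→0} log V(L(Γ)_r)/log r. -/
open UpperHalfPlane MeasureTheory Metric Filter

/-- A subgroup of `SL(2,ℝ)` is discrete (Kleinian/Fuchsian) if it is a discrete subset of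
`SL(2,ℝ)`, viewed inside the space of 2×2 real matrices. -/
def IsDiscreteSubgroup (Γ : Subgroup (Matrix.SpecialLinearGroup (Fin 2) ℝ)) : Prop :=
  DiscreteTopology
    (Set.range fun g : Γ => ((g : Matrix.SpecialLinearGroup (Fin 2) ℝ) : Matrix (Fin 2) (Fin 2) ℝ))

/-- The orbit of the base point `i ∈ ℍ` under a subgroup `Γ ≤ SL(2,ℝ)`, viewed in `ℂ`. -/
def orbitOfI (Γ : Subgroup (Matrix.SpecialLinearGroup (Fin 2) ℝ)) : Set ℂ :=
  Set.range fun g : Γ =>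
    (((g : Matrix.SpecialLinearGroup (Fin 2) ℝ) • UpperHalfPlane.I : UpperHalfPlane) : ℂ)

/-- The limit set of `Γ`: accumulation points of the orbit `Γ·i` in `ℂ`. -/
def limitSet (Γ : Subgroup (Matrix.SpecialLinearGroup (Fin 2) ℝ)) : Set ℂ :=
  closure (orbitOfI Γ) \ orbitOfI Γ

/-- The Poincaré exponent of `Γ`: the exponent of convergence of the Poincaré series
`Σ_{g ∈ Γ} exp(−s·d(i, g·i))`. -/
noncomputable def poincareExponent (Γ : Subgroup (Matrix.SpecialLinearGroup (Fin 2) ℝ)) : ℝ :=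
  sInf {s : ℝ | 0 ≤ s ∧ Summable fun g : Γ =>
    Real.exp (-s * dist UpperHalfPlane.I
      ((g : Matrix.SpecialLinearGroup (Fin 2) ℝ) • UpperHalfPlane.I))}

open Topology
open scoped MatrixGroups

theorem IsDiscreteSubgroup.discreteTopology {Γ : Subgroup SL(2, ℝ)} (h : IsDiscreteSubgroup Γ) :
    DiscreteTopology Γ := by
  have hemb : IsEmbedding fun g : Γ => ((g : SL(2, ℝ)) : Matrix (Fin 2) (Fin 2) ℝ) :=
    Matrix.SpecialLinearGroup.isClosedEmbedding_val.isEmbedding.comp IsEmbedding.subtypeVal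
  have : DiscreteTopology
    (Set.range fun g : Γ => ((g : SL(2, ℝ)) : Matrix (Fin 2) (Fin 2) ℝ)) := h
  exact hemb.toHomeomorph.symm.discreteTopology

theorem finite_smul_I_mem_of_isCompact {Γ : Subgroup SL(2, ℝ)} (h : IsDiscreteSubgroup Γ)
    {K : Set ℍ} (hK : IsCompact K) :
    {g : Γ | (g : SL(2, ℝ)) • UpperHalfPlane.I ∈ K}.Finite := by
  have := h.discreteTopology
  refine (ProperlyDiscontinuousSMul.finite_disjoint_inter_image (Γ := Γ)
    (isCompact_singleton (x := UpperHalfPlane.I)) hK).subset fun g hg => ?_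
  exact ⟨_, ⟨_, rfl, rfl⟩, hg⟩

theorem im_nonneg_of_mem_closure_orbitOfI {Γ : Subgroup SL(2, ℝ)} {a : ℂ}
    (ha : a ∈ closure (orbitOfI Γ)) : 0 ≤ a.im := by
  have hcl : IsClosed {z : ℂ | 0 ≤ z.im} := isClosed_le continuous_const Complex.continuous_im
  refine closure_minimal ?_ hcl ha
  rintro _ ⟨g, rfl⟩
  exact (UpperHalfPlane.im_pos _).le

theorem im_eq_zero_of_mem_limitSet {Γ : Subgroup SL(2, ℝ)} (h : IsDiscreteSubgroup Γ) {a : ℂ}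
    (ha : a ∈ limitSet Γ) : a.im = 0 := by
  refine le_antisymm (not_lt.1 fun hpos => ha.2 ?_) (im_nonneg_of_mem_closure_orbitOfI ha.1)
  let z : ℍ := ⟨a, hpos⟩
  let U : Set ℂ := (fun w : ℍ => (w : ℂ)) '' Metric.ball z 1
  have hU : IsOpen U := UpperHalfPlane.isOpenEmbedding_coe.isOpenMap _ Metric.isOpen_ball
  have haU : a ∈ U := ⟨z, Metric.mem_ball_self one_pos, rfl⟩
  have hfin : (U ∩ orbitOfI Γ).Finite := by
    refine ((finite_smul_I_mem_of_isCompact h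
      (isCompact_closedBall z 1)).image
        fun g : Γ => (((g : SL(2, ℝ)) • UpperHalfPlane.I : ℍ) : ℂ)).subset ?_
    rintro _ ⟨⟨w, hw, hwg⟩, g, rfl⟩
    refine ⟨g, ?_, rfl⟩
    have : w = (g : SL(2, ℝ)) • UpperHalfPlane.I := UpperHalfPlane.ext hwg
    rw [Set.mem_ofPred_eq, ← this]
    exact Metric.ball_subset_closedBall hw
  have := hU.inter_closure ⟨haU, ha.1⟩
  rw [hfin.isClosed.closure_eq] at this
  exact this.2

theorem moebius_mem_limitSet {Γ : Subgroup SL(2, ℝ)} (h : IsDiscreteSubgroup Γ) {a : ℂ}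
    (ha : a ∈ limitSet Γ) (g : Γ) (hden : ((g : SL(2, ℝ)) 1 0 : ℂ) * a + (g : SL(2, ℝ)) 1 1 ≠ 0) :
    (((g : SL(2, ℝ)) 0 0 : ℂ) * a + (g : SL(2, ℝ)) 0 1) /
      (((g : SL(2, ℝ)) 1 0 : ℂ) * a + (g : SL(2, ℝ)) 1 1) ∈ limitSet Γ := by
  have hareal : a = (a.re : ℂ) := by
    apply Complex.ext <;> simp [im_eq_zero_of_mem_limitSet h ha]
  refine ⟨?_, ?_⟩
  · have hcont : ContinuousAt (fun z : ℂ => (((g : SL(2, ℝ)) 0 0 : ℂ) * z + (g : SL(2, ℝ)) 0 1) /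
      (((g : SL(2, ℝ)) 1 0 : ℂ) * z + (g : SL(2, ℝ)) 1 1)) a := by
      fun_prop (disch := exact hden)
    have hmem := mem_closure_image hcont ha.1
    refine closure_mono ?_ hmem
    rintro _ ⟨_, ⟨k, rfl⟩, rfl⟩
    refine ⟨g * k, ?_⟩
    simp [mul_smul, UpperHalfPlane.coe_specialLinearGroup_apply]
  · rintro ⟨k, hk⟩
    have := congrArg Complex.im hk
    have hpos := UpperHalfPlane.im_pos ((k : SL(2, ℝ)) • UpperHalfPlane.I)
    rw [hareal] at this
    norm_cast at this
    exact hpos.ne' this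

theorem im_smul_I (g : SL(2, ℝ)) :
    (g • UpperHalfPlane.I).im = 1 / (g 1 0 ^ 2 + g 1 1 ^ 2) := by
  simp only [MulAction.compHom_smul_def, im_smul_eq_div_normSq,
    Matrix.SpecialLinearGroup.det_mapGL]
  simp [Complex.normSq, denom, sq, add_comm]

theorem exp_neg_dist_I_le (z : ℍ) : Real.exp (-dist UpperHalfPlane.I z) ≤ 2 * z.im := by
  have h1 : Real.exp (-dist UpperHalfPlane.I z) * Real.cosh (dist UpperHalfPlane.I z) ≤ 1 := by
    rw [Real.cosh_eq, mul_div_assoc', mul_add, ← Real.exp_add, ← Real.exp_add]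
    have : Real.exp (-dist UpperHalfPlane.I z + -dist UpperHalfPlane.I z) ≤ 1 :=
      Real.exp_le_one_iff.2 (by linarith [dist_nonneg (x := UpperHalfPlane.I) (y := z)])
    simp; linarith
  have h2 : 1 ≤ 2 * z.im * Real.cosh (dist UpperHalfPlane.I z) := by
    rw [UpperHalfPlane.cosh_dist, Complex.dist_eq, Complex.sq_norm, Complex.normSq_apply]
    have := z.im_pos
    simp
    field_simp
    nlinarith [sq_nonneg z.re]
  have := Real.cosh_pos (dist UpperHalfPlane.I z)
  exact le_of_mul_le_mul_right (h1.trans h2) this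

theorem dist_smul_I_moebius_mul {a : ℝ} (g : SL(2, ℝ)) (hden : g 1 0 * a + g 1 1 ≠ 0) :
    dist ((g • UpperHalfPlane.I : ℍ) : ℂ)
      (((g 0 0 : ℂ) * a + g 0 1) / ((g 1 0 : ℂ) * a + g 1 1)) * |g 1 0 * a + g 1 1| =
      √(1 + a ^ 2) * √((g • UpperHalfPlane.I).im) := by
  have hdet : g 0 0 * g 1 1 - g 0 1 * g 1 0 = 1 := by
    rw [← Matrix.det_fin_two, g.det_coe]
  have hden' : (g 1 0 : ℂ) * a + g 1 1 ≠ 0 := by exact_mod_cast hden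
  have hI : (g 1 0 : ℂ) * Complex.I + g 1 1 ≠ 0 := by
    simpa [denom] using UpperHalfPlane.denom_ne_zero g UpperHalfPlane.I
  have key : ((g • UpperHalfPlane.I : ℍ) : ℂ) -
      ((g 0 0 : ℂ) * a + g 0 1) / ((g 1 0 : ℂ) * a + g 1 1) =
      (Complex.I - a) / (((g 1 0 : ℂ) * Complex.I + g 1 1) * ((g 1 0 : ℂ) * a + g 1 1)) := by
    have hdet' : (g 0 0 : ℂ) * g 1 1 - g 0 1 * g 1 0 = 1 := by exact_mod_cast hdet
    rw [UpperHalfPlane.coe_specialLinearGroup_apply]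
    simp only [Algebra.algebraMap_self, RingHom.id_apply, UpperHalfPlane.coe_I]
    rw [div_sub_div _ _ hI hden']
    congr 1
    linear_combination (Complex.I - a) * hdet'
  have h1 : ‖(g 1 0 : ℂ) * a + g 1 1‖ = |g 1 0 * a + g 1 1| := by
    rw [← Real.norm_eq_abs, ← Complex.norm_real]; push_cast; rfl
  have h2 : ‖Complex.I - a‖ = √(1 + a ^ 2) := by
    rw [Complex.norm_def, Complex.normSq_apply]; congr 1; simp; ring
  have h3 : ‖(g 1 0 : ℂ) * Complex.I + g 1 1‖ = √(g 1 0 ^ 2 + g 1 1 ^ 2) := by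
    rw [Complex.norm_def, Complex.normSq_apply]; congr 1; simp; ring
  rw [Complex.dist_eq, key, norm_div, norm_mul, h1, h2, h3, im_smul_I, Real.sqrt_div zero_le_one,
    Real.sqrt_one]
  have : |g 1 0 * a + g 1 1| ≠ 0 := abs_ne_zero.2 hden
  rw [← div_div, div_mul_cancel₀ _ this, div_eq_mul_one_div]

/-- The Euclidean distance from an orbit point to the limit set is controlled by its height. -/
theorem exists_dist_limitSet_le_mul_im {Γ : Subgroup SL(2, ℝ)} (h : IsDiscreteSubgroup Γ)
    {a b : ℂ} (ha : a ∈ limitSet Γ) (hb : b ∈ limitSet Γ) (hab : a ≠ b) :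
    ∃ K : ℝ, 0 ≤ K ∧ ∀ g : Γ, ∃ w ∈ limitSet Γ,
      dist ((((g : SL(2, ℝ)) • UpperHalfPlane.I : ℍ)) : ℂ) w ≤
        K * ((g : SL(2, ℝ)) • UpperHalfPlane.I).im := by
  obtain ⟨a, rfl⟩ : ∃ x : ℝ, (x : ℂ) = a :=
    ⟨a.re, by apply Complex.ext <;> simp [im_eq_zero_of_mem_limitSet h ha]⟩
  obtain ⟨b, rfl⟩ : ∃ x : ℝ, (x : ℂ) = b :=
    ⟨b.re, by apply Complex.ext <;> simp [im_eq_zero_of_mem_limitSet h hb]⟩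
  have hab' : a - b ≠ 0 := sub_ne_zero.2 fun h => hab (by rw [h])
  have hpos : 0 < (a - b) ^ 2 := by positivity
  set M : ℝ := 2 * (1 + a ^ 2 + (1 + b ^ 2)) with hM
  have hMpos : 0 < M := by positivity
  refine ⟨M / |a - b|, by positivity, fun g => ?_⟩
  set c := (g : SL(2, ℝ)) 1 0
  set d := (g : SL(2, ℝ)) 1 1
  have hcd : 0 < c ^ 2 + d ^ 2 := by
    have := (((g : SL(2, ℝ)) • UpperHalfPlane.I)).im_pos
    rw [im_smul_I] at this
    exact one_div_pos.1 this
  have main : ∀ x : ℝ, (x : ℂ) ∈ limitSet Γ → x ^ 2 ≤ M - 1 →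
      (a - b) ^ 2 * (c ^ 2 + d ^ 2) ≤ M * (c * x + d) ^ 2 → ∃ w ∈ limitSet Γ,
      dist ((((g : SL(2, ℝ)) • UpperHalfPlane.I : ℍ)) : ℂ) w ≤
        M / |a - b| * ((g : SL(2, ℝ)) • UpperHalfPlane.I).im := by
    intro x hx hxM hle
    have hden : c * x + d ≠ 0 := by
      intro h0
      rw [h0] at hle
      have : 0 < (a - b) ^ 2 * (c ^ 2 + d ^ 2) := by positivity
      linarith
    refine ⟨_, moebius_mem_limitSet h hx g (by exact_mod_cast hden), ?_⟩
    have hkey := dist_smul_I_moebius_mul (g : SL(2, ℝ)) hden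
    set D := dist ((((g : SL(2, ℝ)) • UpperHalfPlane.I : ℍ)) : ℂ)
      ((((g : SL(2, ℝ)) 0 0 : ℂ) * x + (g : SL(2, ℝ)) 0 1) /
        (((g : SL(2, ℝ)) 1 0 : ℂ) * x + (g : SL(2, ℝ)) 1 1))
    have hD : 0 ≤ D := dist_nonneg
    rw [im_smul_I] at hkey ⊢
    change D * |c * x + d| = √(1 + x ^ 2) * √(1 / (c ^ 2 + d ^ 2)) at hkey
    change D ≤ M / |a - b| * (1 / (c ^ 2 + d ^ 2))
    have hsq : D ^ 2 * (c * x + d) ^ 2 * (c ^ 2 + d ^ 2) = 1 + x ^ 2 := by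
      have := congrArg (· ^ 2) hkey
      simp only [mul_pow, sq_abs] at this
      rw [Real.sq_sqrt (by positivity), Real.sq_sqrt (by positivity)] at this
      rw [this]; field_simp
    refine abs_le_of_sq_le_sq' ?_ (by positivity) |>.2
    rw [mul_pow, div_pow, sq_abs, one_div, inv_pow, ← div_eq_mul_inv, div_div,
      le_div_iff₀ (by positivity)]
    calc D ^ 2 * ((a - b) ^ 2 * (c ^ 2 + d ^ 2) ^ 2)
        = D ^ 2 * (c ^ 2 + d ^ 2) * ((a - b) ^ 2 * (c ^ 2 + d ^ 2)) := by ring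
      _ ≤ D ^ 2 * (c ^ 2 + d ^ 2) * (M * (c * x + d) ^ 2) := by gcongr
      _ = M * (1 + x ^ 2) := by rw [← hsq]; ring
      _ ≤ M ^ 2 := by nlinarith
  have hsum : (a - b) ^ 2 * (c ^ 2 + d ^ 2) ≤
      M / 2 * ((c * a + d) ^ 2 + (c * b + d) ^ 2) := by
    rw [hM]
    nlinarith [sq_nonneg (c * a + d + (c * b + d)),
      sq_nonneg (a * (c * a + d) + b * (c * b + d))]
  rcases le_total ((c * b + d) ^ 2) ((c * a + d) ^ 2) with hle | hle
  · exact main a ha (by nlinarith [sq_nonneg a, sq_nonneg b]) (hsum.trans (by nlinarith))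
  · exact main b hb (by nlinarith [sq_nonneg a, sq_nonneg b]) (hsum.trans (by nlinarith))

theorem finset_card_mul_le_of_bounded_overlap {α ι : Type*} [MeasurableSpace α] {μ : Measure α}
    (T : Finset ι) (B : ι → Set α) (S : Set α) (N : ℕ) (v : ENNReal)
    (hB : ∀ t ∈ T, MeasurableSet (B t)) (hS : MeasurableSet S) (hBS : ∀ t ∈ T, B t ⊆ S)
    (hv : ∀ t ∈ T, v ≤ μ (B t))
    (hN : ∀ x, ∀ T' ⊆ T, (∀ t ∈ T', x ∈ B t) → T'.card ≤ N) :
    T.card * v ≤ N * μ S := by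
  classical
  calc (T.card : ENNReal) * v = ∑ _t ∈ T, v := by simp
    _ ≤ ∑ t ∈ T, μ (B t) := Finset.sum_le_sum hv
    _ = ∑ t ∈ T, ∫⁻ x, (B t).indicator 1 x ∂μ :=
        Finset.sum_congr rfl fun t ht => (lintegral_indicator_one (hB t ht)).symm
    _ = ∫⁻ x, ∑ t ∈ T, (B t).indicator 1 x ∂μ :=
        (lintegral_finsetSum' _ fun t ht => (measurable_one.indicator (hB t ht)).aemeasurable).symm
    _ ≤ ∫⁻ x, N * S.indicator 1 x ∂μ := by
        refine lintegral_mono fun x => ?_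
        by_cases hx : x ∈ S
        · have : ∑ t ∈ T, (B t).indicator (1 : α → ENNReal) x =
              ((T.filter fun t => x ∈ B t).card : ENNReal) := by
            simp [Set.indicator_apply]
          simp only [this, Set.indicator_of_mem hx, Pi.one_apply, mul_one]
          exact_mod_cast hN x _ (Finset.filter_subset _ _) fun t ht => (Finset.mem_filter.1 ht).2
        · have : ∑ t ∈ T, (B t).indicator (1 : α → ENNReal) x = 0 :=
            Finset.sum_eq_zero fun t ht => Set.indicator_of_notMem (fun h => hx (hBS t ht h)) _
          simp [this]
    _ = N * μ S := by
        rw [lintegral_const_mul _ (measurable_one.indicator hS), lintegral_indicator_one hS]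

theorem exists_card_mul_sq_le_volume_cthickening {Γ : Subgroup SL(2, ℝ)}
    (h : IsDiscreteSubgroup Γ) {a b : ℂ} (ha : a ∈ limitSet Γ) (hb : b ∈ limitSet Γ)
    (hab : a ≠ b) :
    ∃ (C : ℝ) (N : ℕ), 0 < C ∧ ∀ ρ > 0, ∀ T : Finset Γ,
      (∀ g ∈ T, ρ ≤ ((g : SL(2, ℝ)) • UpperHalfPlane.I).im ∧
        ((g : SL(2, ℝ)) • UpperHalfPlane.I).im ≤ 2 * ρ) →
      (T.card : ENNReal) * ENNReal.ofReal ρ ^ 2 ≤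
        N * volume (cthickening (C * ρ) (limitSet Γ)) := by
  obtain ⟨K, hK0, hK⟩ := exists_dist_limitSet_le_mul_im h ha hb hab
  have hF := finite_smul_I_mem_of_isCompact h
    (isCompact_closedBall UpperHalfPlane.I (Real.arcosh 3))
  refine ⟨2 * K + 1, hF.toFinset.card, by positivity, fun ρ hρ T hT => ?_⟩
  refine finset_card_mul_le_of_bounded_overlap T
    (fun g => Metric.closedBall ((((g : SL(2, ℝ)) • UpperHalfPlane.I : ℍ)) : ℂ) ρ) _ _ _
    (fun _ _ => measurableSet_closedBall) isClosed_cthickening.measurableSet ?_ ?_ ?_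
  · intro g hg z hz
    obtain ⟨w, hw, hgw⟩ := hK g
    refine mem_cthickening_of_dist_le z w _ _ hw ?_
    have h1 : dist z w ≤ _ := dist_triangle z ((((g : SL(2, ℝ)) • UpperHalfPlane.I : ℍ)) : ℂ) w
    have h2 := mul_le_mul_of_nonneg_left (hT g hg).2 hK0
    have h3 : dist z _ ≤ ρ := hz
    linarith
  · intro g hg
    rw [Complex.volume_closedBall]
    refine le_mul_of_one_le_right zero_le ?_
    have : (1 : NNReal) ≤ NNReal.pi := by
      rw [← NNReal.coe_le_coe]; simpa using (by linarith [Real.pi_gt_three] : 1 ≤ Real.pi)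
    exact_mod_cast this
  · intro x T' hT' hx
    rcases T'.eq_empty_or_nonempty with rfl | ⟨g, hg⟩
    · simp
    refine Finset.card_le_card_of_injOn (fun k => g⁻¹ * k) ?_ fun _ _ _ _ hk =>
      mul_left_cancel hk
    intro k hk
    have hgT := hT g (hT' hg)
    have hkT := hT k (hT' hk)
    rw [Finset.mem_coe, Set.Finite.mem_toFinset, Set.mem_ofPred_eq, Metric.mem_closedBall,
      dist_comm, Subgroup.coe_mul, mul_smul, Subgroup.coe_inv,
      ← dist_smul (g : SL(2, ℝ)), smul_inv_smul]
    rw [← Real.arcosh_cosh dist_nonneg,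
      Real.arcosh_le_arcosh (Real.cosh_pos _) (by norm_num), UpperHalfPlane.cosh_dist]
    set z := (g : SL(2, ℝ)) • UpperHalfPlane.I
    set w := (k : SL(2, ℝ)) • UpperHalfPlane.I
    have hz := z.im_pos
    have hw := w.im_pos
    have hd : dist (z : ℂ) w ≤ 2 * ρ := by
      have h1 : dist x (z : ℂ) ≤ ρ := hx g hg
      have h2 : dist x (w : ℂ) ≤ ρ := hx k hk
      linarith [dist_triangle_left (z : ℂ) w x]
    have h4 : dist (z : ℂ) w ^ 2 ≤ (2 * ρ) ^ 2 := by gcongr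
    have h5 : ρ * ρ ≤ z.im * w.im := mul_le_mul hgT.1 hkT.1 hρ.le hz.le
    have : dist (z : ℂ) w ^ 2 / (2 * z.im * w.im) ≤ 2 := by
      rw [div_le_iff₀ (by positivity)]
      nlinarith
    linarith

theorem volume_cthickening_ne_top {L : Set ℂ} (hL : Bornology.IsBounded L) (r : ℝ) :
    volume (cthickening r L) ≠ ⊤ :=
  hL.cthickening.measure_lt_top.ne

theorem sq_le_volume_cthickening {L : Set ℂ} (hL : Bornology.IsBounded L) (hne : L.Nonempty)
    {r : ℝ} (hr : 0 < r) : r ^ 2 ≤ (volume (cthickening r L)).toReal := by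
  obtain ⟨x, hx⟩ := hne
  have h1 : volume (Metric.closedBall x r) ≤ volume (cthickening r L) :=
    measure_mono (closedBall_subset_cthickening hx r)
  have h2 := ENNReal.toReal_mono (volume_cthickening_ne_top hL r) h1
  rw [Complex.volume_closedBall] at h2
  simp only [ENNReal.toReal_mul, ENNReal.toReal_pow, ENNReal.toReal_ofReal hr.le,
    ENNReal.coe_toReal, NNReal.coe_real_pi] at h2
  nlinarith [Real.pi_gt_three, sq_nonneg r]

theorem log_volume_cthickening_div_log_le_two {L : Set ℂ} (hL : Bornology.IsBounded L)
    (hne : L.Nonempty) {r : ℝ} (hr : 0 < r) (hr1 : r < 1) :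
    Real.log (volume (cthickening r L)).toReal / Real.log r ≤ 2 := by
  rw [div_le_iff_of_neg (Real.log_neg hr hr1)]
  have := Real.log_le_log (by positivity) (sq_le_volume_cthickening hL hne hr)
  rw [Real.log_pow] at this
  exact_mod_cast this

theorem isBoundedUnder_ge_log_volume_cthickening {L : Set ℂ} (hL : Bornology.IsBounded L)
    (hne : L.Nonempty) :
    (𝓝[>] (0 : ℝ)).IsBoundedUnder (· ≥ ·)
      fun r => Real.log (volume (cthickening r L)).toReal / Real.log r := by
  set M := (volume (cthickening 1 L)).toReal
  have hlim : Tendsto (fun r => Real.log M / Real.log r) (𝓝[>] (0 : ℝ)) (𝓝 0) :=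
    Real.tendsto_log_nhdsGT_zero.const_div_atBot _
  refine ⟨-1, eventually_map.2 ?_⟩
  filter_upwards [hlim.eventually (eventually_ge_nhds (show (-1 : ℝ) < 0 by norm_num)),
    Ioo_mem_nhdsGT one_pos] with r hr hr1
  refine le_trans hr ?_
  have hpos : 0 < (volume (cthickening r L)).toReal :=
    (pow_pos hr1.1 2).trans_le (sq_le_volume_cthickening hL hne hr1.1)
  refine div_le_div_of_nonpos_of_le (Real.log_neg hr1.1 hr1.2).le ?_
  exact Real.log_le_log hpos (ENNReal.toReal_mono (volume_cthickening_ne_top hL 1)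
    (measure_mono (cthickening_mono hr1.2.le L)))

theorem liminf_log_volume_cthickening_le_two {L : Set ℂ} (hL : Bornology.IsBounded L)
    (hne : L.Nonempty) :
    liminf (fun r => Real.log (volume (cthickening r L)).toReal / Real.log r) (𝓝[>] (0 : ℝ)) ≤
      2 := by
  refine liminf_le_of_frequently_le (Eventually.frequently ?_)
    (isBoundedUnder_ge_log_volume_cthickening hL hne)
  filter_upwards [Ioo_mem_nhdsGT one_pos] with r hr
  exact log_volume_cthickening_div_log_le_two hL hne hr.1 hr.2

theorem eventually_volume_cthickening_le_rpow {L : Set ℂ} (hL : Bornology.IsBounded L)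
    (hne : L.Nonempty) {l : ℝ}
    (hl : l < liminf (fun r => Real.log (volume (cthickening r L)).toReal / Real.log r)
      (𝓝[>] (0 : ℝ))) :
    ∀ᶠ r in 𝓝[>] (0 : ℝ), (volume (cthickening r L)).toReal ≤ r ^ l := by
  filter_upwards [eventually_lt_of_lt_liminf hl (isBoundedUnder_ge_log_volume_cthickening hL hne),
    Ioo_mem_nhdsGT one_pos] with r hr hr1
  have hpos : 0 < (volume (cthickening r L)).toReal :=
    (pow_pos hr1.1 2).trans_le (sq_le_volume_cthickening hL hne hr1.1)
  rw [lt_div_iff_of_neg (Real.log_neg hr1.1 hr1.2)] at hr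
  rw [Real.le_rpow_iff_log_le hpos hr1.1]
  exact hr.le

theorem exists_forall_card_le_rpow {Γ : Subgroup SL(2, ℝ)}
    (h : IsDiscreteSubgroup Γ) (hL : Bornology.IsBounded (limitSet Γ)) {a b : ℂ}
    (ha : a ∈ limitSet Γ) (hb : b ∈ limitSet Γ) (hab : a ≠ b) {l Y : ℝ} (hY : 0 < Y)
    (hl : l < liminf (fun r => Real.log (volume (cthickening r (limitSet Γ))).toReal / Real.log r)
      (𝓝[>] (0 : ℝ))) :
    ∃ A : ℝ, ∀ (n : ℕ) (T : Finset Γ),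
      (∀ g ∈ T, Y * (1 / 2) ^ (n + 1) < ((g : SL(2, ℝ)) • UpperHalfPlane.I).im ∧
        ((g : SL(2, ℝ)) • UpperHalfPlane.I).im ≤ Y * (1 / 2) ^ n) →
      (T.card : ℝ) ≤ A * (((1 / 2 : ℝ) ^ n) ^ (l - 2)) := by
  obtain ⟨C, N, hC, hCN⟩ := exists_card_mul_sq_le_volume_cthickening h ha hb hab
  let ρ : ℕ → ℝ := fun n => Y * (1 / 2) ^ (n + 1)
  let V : ℕ → ℝ := fun n => (volume (cthickening (C * ρ n) (limitSet Γ))).toReal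
  have hρ : ∀ n, 0 < ρ n := fun n => by positivity
  have hlim : Tendsto (fun n => C * ρ n) atTop (𝓝[>] 0) := by
    refine tendsto_nhdsWithin_iff.2 ⟨?_, Eventually.of_forall fun n => mul_pos hC (hρ n)⟩
    have := (tendsto_pow_atTop_nhds_zero_of_lt_one (r := (1 / 2 : ℝ)) (by norm_num)
      (by norm_num)).comp (tendsto_add_atTop_nat 1)
    simpa [ρ] using (this.const_mul Y).const_mul C
  have hbdd : BddAbove (Set.range fun n => V n / (C * ρ n) ^ l) := by
    refine IsBoundedUnder.bddAbove_range ⟨1, eventually_map.2 ?_⟩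
    filter_upwards [hlim.eventually (eventually_volume_cthickening_le_rpow hL ⟨a, ha⟩ hl)]
      with n hn
    exact div_le_one_of_le₀ hn (Real.rpow_nonneg (mul_pos hC (hρ n)).le _)
  obtain ⟨B, hB⟩ := hbdd
  refine ⟨N * B * C ^ l * (Y / 2) ^ (l - 2), fun n T hT => ?_⟩
  have h1 := hCN (ρ n) (hρ n) T fun g hg =>
    ⟨(hT g hg).1.le, (hT g hg).2.trans_eq (by simp only [ρ]; ring)⟩
  have h2 := ENNReal.toReal_mono
    (ENNReal.mul_ne_top (by simp) (volume_cthickening_ne_top hL _)) h1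
  simp only [ENNReal.toReal_mul, ENNReal.toReal_pow, ENNReal.toReal_ofReal (hρ n).le,
    ENNReal.toReal_natCast] at h2
  have h3 : V n ≤ B * (C * ρ n) ^ l :=
    (div_le_iff₀ (Real.rpow_pos_of_pos (mul_pos hC (hρ n)) _)).1 (hB ⟨n, rfl⟩)
  have h4 : (T.card : ℝ) * ρ n ^ 2 ≤ N * (B * (C * ρ n) ^ l) :=
    h2.trans (mul_le_mul_of_nonneg_left h3 (Nat.cast_nonneg _))
  rw [← le_div_iff₀ (pow_pos (hρ n) 2)] at h4
  refine h4.trans_eq ?_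
  have h5 : ρ n = Y / 2 * (1 / 2) ^ n := by simp only [ρ]; ring
  rw [mul_assoc, ← Real.mul_rpow (by positivity) (by positivity), ← h5,
    Real.rpow_sub (hρ n), Real.mul_rpow hC.le (hρ n).le, Real.rpow_two]
  ring

theorem summable_exp_neg_mul_dist {Γ : Subgroup SL(2, ℝ)}
    (h : IsDiscreteSubgroup Γ) (hbdd : Bornology.IsBounded (orbitOfI Γ))
    (hL : Bornology.IsBounded (limitSet Γ)) {a b : ℂ}
    (ha : a ∈ limitSet Γ) (hb : b ∈ limitSet Γ) (hab : a ≠ b) {s : ℝ} (hs0 : 0 ≤ s)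
    (hs : 2 - liminf (fun r => Real.log (volume (cthickening r (limitSet Γ))).toReal / Real.log r)
      (𝓝[>] (0 : ℝ)) < s) :
    Summable fun g : Γ => Real.exp (-s * dist UpperHalfPlane.I
      ((g : SL(2, ℝ)) • UpperHalfPlane.I)) := by
  classical
  obtain ⟨l, hl1, hl2⟩ := exists_between (sub_lt_comm.1 hs)
  obtain ⟨Y, hY⟩ := hbdd.exists_norm_le
  have him : ∀ g : Γ, ((g : SL(2, ℝ)) • UpperHalfPlane.I).im ≤ Y := fun g =>
    (Complex.im_le_norm _).trans (hY _ ⟨g, rfl⟩)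
  have hYpos : 0 < Y := (UpperHalfPlane.im_pos _).trans_le (him 1)
  obtain ⟨A, hA⟩ := exists_forall_card_le_rpow h hL ha hb hab hYpos hl2
  have hlev : ∀ g : Γ, ∃ n : ℕ, Y * (1 / 2) ^ (n + 1) < ((g : SL(2, ℝ)) • UpperHalfPlane.I).im ∧
      ((g : SL(2, ℝ)) • UpperHalfPlane.I).im ≤ Y * (1 / 2) ^ n := fun g => by
    obtain ⟨n, h1, h2⟩ := exists_nat_pow_near_of_lt_one
      (div_pos (UpperHalfPlane.im_pos ((g : SL(2, ℝ)) • UpperHalfPlane.I)) hYpos)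
      ((div_le_one hYpos).2 (him g)) (y := (1 / 2 : ℝ)) (by norm_num) (by norm_num)
    exact ⟨n, by rwa [lt_div_iff₀' hYpos] at h1, by rwa [div_le_iff₀' hYpos] at h2⟩
  choose n hn using hlev
  have hterm : ∀ g : Γ, Real.exp (-s * dist UpperHalfPlane.I ((g : SL(2, ℝ)) • UpperHalfPlane.I))
      ≤ (2 * Y) ^ s * ((1 / 2 : ℝ) ^ n g) ^ s := fun g => by
    rw [← Real.mul_rpow (by positivity) (by positivity), neg_mul, mul_comm, ← neg_mul,
      Real.exp_mul]
    refine Real.rpow_le_rpow (Real.exp_pos _).le ((exp_neg_dist_I_le _).trans ?_) hs0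
    linarith [(hn g).2]
  set q : ℝ := (1 / 2 : ℝ) ^ (s + (l - 2))
  have hq0 : 0 ≤ q := by positivity
  have hq1 : q < 1 := Real.rpow_lt_one (by norm_num) (by norm_num) (by linarith)
  have hgeom : Summable fun k : ℕ => (2 * Y) ^ s * A * q ^ k :=
    (summable_geometric_of_lt_one hq0 hq1).mul_left _
  have hA0 : 0 ≤ A := by simpa using hA 0 ∅ (by simp)
  refine summable_of_sum_le (c := ∑' k : ℕ, (2 * Y) ^ s * A * q ^ k)
    (fun _ => (Real.exp_pos _).le) fun u => ?_
  refine le_trans ?_ (hgeom.sum_le_tsum (u.image n) fun k _ => by positivity)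
  rw [← Finset.sum_fiberwise_of_maps_to fun g hg => Finset.mem_image_of_mem n hg]
  refine Finset.sum_le_sum fun k _ => ?_
  calc ∑ g ∈ u with n g = k,
        Real.exp (-s * dist UpperHalfPlane.I ((g : SL(2, ℝ)) • UpperHalfPlane.I))
      ≤ (u.filter fun g => n g = k).card • ((2 * Y) ^ s * ((1 / 2 : ℝ) ^ k) ^ s) :=
        Finset.sum_le_card_nsmul _ _ _ fun g hg => by
          simpa only [(Finset.mem_filter.1 hg).2] using hterm g
    _ ≤ (A * ((1 / 2 : ℝ) ^ k) ^ (l - 2)) * ((2 * Y) ^ s * ((1 / 2 : ℝ) ^ k) ^ s) := by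
        rw [nsmul_eq_mul]
        refine mul_le_mul_of_nonneg_right (hA k _ fun g hg => ?_) (by positivity)
        exact (Finset.mem_filter.1 hg).2 ▸ hn g
    _ = (2 * Y) ^ s * A * q ^ k := by
        have : q ^ k = ((1 / 2 : ℝ) ^ k) ^ s * ((1 / 2 : ℝ) ^ k) ^ (l - 2) := by
          rw [← Real.rpow_add (by positivity), ← Real.rpow_natCast, ← Real.rpow_natCast,
            ← Real.rpow_mul (by norm_num), ← Real.rpow_mul (by norm_num), mul_comm]
        rw [this]; ring

/-- If `Γ ≤ SL(2,ℝ)` is discrete, the orbit `Γ·i` is bounded in `ℂ`, and the limit set has at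
least 3 points, then the Poincaré exponent is at most the upper box dimension of the limit set,
`2 − liminf_{r→0⁺} log V(L(Γ)_r) / log r`. -/
theorem poincareExponent_le_upperBoxDim_limitSet
    (Γ : Subgroup (Matrix.SpecialLinearGroup (Fin 2) ℝ))
    (hdisc : IsDiscreteSubgroup Γ)
    (hbdd : Bornology.IsBounded (orbitOfI Γ))
    (hnonelem : ∃ a b c : ℂ, a ∈ limitSet Γ ∧ b ∈ limitSet Γ ∧ c ∈ limitSet Γ ∧
      a ≠ b ∧ a ≠ c ∧ b ≠ c) :
    poincareExponent Γ ≤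
      2 - Filter.liminf
        (fun r : ℝ => Real.log (volume (cthickening r (limitSet Γ))).toReal / Real.log r)
        (nhdsWithin 0 (Set.Ioi 0)) := by
  obtain ⟨a, b, -, ha, hb, -, hab, -, -⟩ := hnonelem
  have hL : Bornology.IsBounded (limitSet Γ) := hbdd.closure.subset Set.sdiff_subset
  refine le_of_forall_gt_imp_ge_of_dense fun s hs => csInf_le ⟨0, fun _ ht => ht.1⟩ ?_
  have hs0 : 0 ≤ s := by linarith [liminf_log_volume_cthickening_le_two hL ⟨a, ha⟩]
  exact ⟨hs0, summable_exp_neg_mul_dist hdisc hbdd hL ha hb hab hs0 hs⟩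
end

section
/- Let Γ be a discrete subgroup of SL(2,ℝ) acting on the upper half-plane ℍ whose limit set L(Γ) contains at least 3 points (Γ is non-elementary). Then Γ contains a loxodromic element, i.e. there exists h ∈ Γ with |tr h| > 2. -/
open UpperHalfPlane Metric

open Filter Topology Matrix in
/-- The limit points of a discrete subgroup of `SL(2,ℝ)` are real. -/
lemma im_eq_zero_of_mem_limitSet_s8 {Γ : Subgroup (SpecialLinearGroup (Fin 2) ℝ)}
    (hdisc : IsDiscreteSubgroup Γ) {x : ℂ} (hx : x ∈ limitSet Γ) : x.im = 0 := by
  have hΓ : DiscreteTopology Γ := by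
    have : DiscreteTopology (Set.range fun g : Γ =>
      ((g : SpecialLinearGroup (Fin 2) ℝ) : Matrix (Fin 2) (Fin 2) ℝ)) := hdisc
    have hcont : Continuous fun g : Γ =>
        ((g : SpecialLinearGroup (Fin 2) ℝ) : Matrix (Fin 2) (Fin 2) ℝ) :=
      SpecialLinearGroup.isClosedEmbedding_val.continuous.comp continuous_subtype_val
    exact DiscreteTopology.of_continuous_injective
      (β := Set.range fun g : Γ =>
        ((g : SpecialLinearGroup (Fin 2) ℝ) : Matrix (Fin 2) (Fin 2) ℝ))
      (hcont.subtype_mk Set.mem_range_self)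
      fun g h hgh => Subtype.ext (Subtype.ext (Subtype.mk.inj hgh))
  have hclosed : IsClosed ((fun g : SpecialLinearGroup (Fin 2) ℝ => g • I) '' (Γ : Set _)) :=
    isProperMap_smul_I.isClosedMap _ Subgroup.isClosed_of_discrete
  obtain ⟨hxc, hxo⟩ := hx
  have hnonneg : 0 ≤ x.im := by
    refine closure_minimal ?_ (isClosed_le continuous_const Complex.continuous_im) hxc
    rintro _ ⟨g, rfl⟩
    exact ((g : SpecialLinearGroup (Fin 2) ℝ) • I).im_pos.le
  refine le_antisymm (not_lt.1 fun hpos => hxo ?_) hnonneg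
  have hmem : (⟨x, hpos⟩ : UpperHalfPlane) ∈
      closure ((fun g : SpecialLinearGroup (Fin 2) ℝ => g • I) '' (Γ : Set _)) := by
    rw [isOpenEmbedding_coe.isInducing.closure_eq_preimage_closure_image]
    refine closure_mono ?_ hxc
    rintro _ ⟨g, rfl⟩
    exact ⟨_, ⟨g, g.2, rfl⟩, rfl⟩
  rw [hclosed.closure_eq] at hmem
  obtain ⟨g, hg, hgx⟩ := hmem
  exact ⟨⟨g, hg⟩, congrArg UpperHalfPlane.coe hgx⟩

open Matrix in
/-- The matrix entries of `g` in terms of its lower row and the point `g • i`. -/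
lemma entries_eq_of_smul_I (g : SpecialLinearGroup (Fin 2) ℝ) :
    g 0 0 = (g • I).re * g 1 0 + (g • I).im * g 1 1 ∧
    g 0 1 = (g • I).re * g 1 1 - (g • I).im * g 1 0 ∧
    (g • I).im * (g 1 0 ^ 2 + g 1 1 ^ 2) = 1 := by
  have hdet : g 0 0 * g 1 1 - g 0 1 * g 1 0 = 1 := by
    rw [← Matrix.det_fin_two]; exact g.2
  have hne : ((g 1 0 : ℝ) : ℂ) * Complex.I + ((g 1 1 : ℝ) : ℂ) ≠ 0 := by
    intro h
    have h₁ : g 1 1 = 0 := by simpa using congrArg Complex.re h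
    have h₂ : g 1 0 = 0 := by simpa using congrArg Complex.im h
    simp [h₁, h₂] at hdet
  have hz := coe_specialLinearGroup_apply g I
  simp only [Algebra.algebraMap_self, RingHom.id_apply, coe_I] at hz
  rw [eq_div_iff hne] at hz
  have hre := congrArg Complex.re hz
  have him := congrArg Complex.im hz
  simp only [Complex.mul_re, Complex.mul_im, Complex.add_re, Complex.add_im, Complex.ofReal_re,
    Complex.ofReal_im, Complex.I_re, Complex.I_im, coe_re, coe_im] at hre him
  have ha : g 0 0 = (g • I).re * g 1 0 + (g • I).im * g 1 1 := by linarith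
  have hb : g 0 1 = (g • I).re * g 1 1 - (g • I).im * g 1 0 := by linarith
  refine ⟨ha, hb, ?_⟩
  rw [ha, hb] at hdet
  linarith

open Filter Topology Matrix in
/-- If no element of a discrete group has `|tr| > 2`, then every limit point `x` is the limit of
elements whose matrices, rescaled, converge to the nilpotent matrix with kernel and image spanned
by `(x, 1)`. -/
lemma exists_seq_tendsto_nilpotent {Γ : Subgroup (SpecialLinearGroup (Fin 2) ℝ)}
    (hdisc : IsDiscreteSubgroup Γ)
    (htr : ∀ g ∈ Γ, |trace (g : Matrix (Fin 2) (Fin 2) ℝ)| ≤ 2)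
    {x : ℂ} (hx : x ∈ limitSet Γ) :
    ∃ g : ℕ → SpecialLinearGroup (Fin 2) ℝ, (∀ n, g n ∈ Γ) ∧
      (∀ᶠ n in atTop, g n 1 0 ≠ 0) ∧
      Tendsto (fun n => (g n 1 0)⁻¹) atTop (𝓝 0) ∧
      Tendsto (fun n => g n 0 0 / g n 1 0) atTop (𝓝 x.re) ∧
      Tendsto (fun n => g n 0 1 / g n 1 0) atTop (𝓝 (-x.re ^ 2)) ∧
      Tendsto (fun n => g n 1 1 / g n 1 0) atTop (𝓝 (-x.re)) := by
  have hxim := im_eq_zero_of_mem_limitSet_s8 hdisc hx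
  obtain ⟨z, hz, hzx⟩ := mem_closure_iff_seq_limit.1 hx.1
  choose γ hγ using hz
  let g : ℕ → SpecialLinearGroup (Fin 2) ℝ := fun n => γ n
  have hg : ∀ n, ((g n • I : UpperHalfPlane) : ℂ) = z n := hγ
  have hr : Tendsto (fun n => (g n • I).re) atTop (𝓝 x.re) := by
    refine ((Complex.continuous_re.tendsto x).comp hzx).congr fun n => ?_
    rw [Function.comp_apply, ← hg, coe_re]
  have hs : Tendsto (fun n => (g n • I).im) atTop (𝓝 0) := by
    rw [← hxim]
    refine ((Complex.continuous_im.tendsto x).comp hzx).congr fun n => ?_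
    rw [Function.comp_apply, ← hg, coe_im]
  have hmem : ∀ n, g n ∈ Γ := fun n => (γ n).2
  have htr' : ∀ n, |g n 0 0 + g n 1 1| ≤ 2 := fun n => by
    simpa [Matrix.trace_fin_two] using htr _ (hmem n)
  clear_value g
  have hsinv : Tendsto (fun n => ((g n • I).im)⁻¹) atTop atTop :=
    tendsto_inv_nhdsGT_zero.comp (tendsto_nhdsWithin_iff.2
      ⟨hs, Eventually.of_forall fun n => (g n • I).im_pos⟩)
  have hc2 : Tendsto (fun n => g n 1 0 ^ 2) atTop atTop := by
    have hlim : Tendsto (fun n => (1 + 2 * (g n • I).re ^ 2)⁻¹) atTop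
        (𝓝 (1 + 2 * x.re ^ 2)⁻¹) :=
      (((hr.pow 2).const_mul 2).const_add 1).inv₀ (by positivity)
    refine tendsto_atTop_mono (fun n => ?_)
      ((tendsto_atTop_add_const_right atTop (-8) hsinv).atTop_mul_pos (by positivity) hlim)
    obtain ⟨ha, -, hP⟩ := entries_eq_of_smul_I (g n)
    have hspos := (g n • I).im_pos
    have ht := abs_le.1 (htr' n)
    have hsi : ((g n • I).im)⁻¹ = g n 1 0 ^ 2 + g n 1 1 ^ 2 :=
      (eq_inv_of_mul_eq_one_right hP).symm
    rw [hsi, ← div_eq_mul_inv, div_le_iff₀ (by positivity)]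
    rw [ha] at ht
    generalize (g n • I).re = r at *
    generalize (g n • I).im = s at *
    generalize g n 1 0 = c at *
    generalize g n 1 1 = d at *
    have h₁ : (r * c + s * d + d) ^ 2 ≤ 4 := by nlinarith
    have h₂ : (d * (1 + s)) ^ 2 ≤ 8 + 2 * (r * c) ^ 2 := by
      nlinarith [sq_nonneg (r * c + s * d + d + r * c)]
    have h₃ : d ^ 2 ≤ (d * (1 + s)) ^ 2 := by
      nlinarith [mul_nonneg (sq_nonneg d) hspos.le, mul_nonneg (sq_nonneg d) (sq_nonneg s)]
    nlinarith
  have hne : ∀ᶠ n in atTop, g n 1 0 ≠ 0 := by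
    filter_upwards [hc2.eventually_gt_atTop 0] with n hn h
    simp [h] at hn
  have hcinv : Tendsto (fun n => (g n 1 0)⁻¹) atTop (𝓝 0) := by
    have h := (Real.continuous_sqrt.tendsto 0).comp (tendsto_inv_atTop_zero.comp hc2)
    rw [Real.sqrt_zero] at h
    refine tendsto_zero_iff_abs_tendsto_zero _ |>.2 (h.congr fun n => ?_)
    simp [← inv_pow, Real.sqrt_sq_eq_abs]
  have htc : Tendsto (fun n => (g n 0 0 + g n 1 1) * (g n 1 0)⁻¹) atTop (𝓝 0) := by
    refine bdd_le_mul_tendsto_zero' 2 (Eventually.of_forall htr') hcinv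
  have hd : Tendsto (fun n => g n 1 1 / g n 1 0) atTop (𝓝 (-x.re)) := by
    have h := (htc.sub hr).div (hs.const_add 1) (by norm_num)
    rw [zero_sub, add_zero, div_one] at h
    refine h.congr' ?_
    filter_upwards [hne] with n hn
    have hspos := (g n • I).im_pos
    have hs1 : 1 + (g n • I).im ≠ 0 := by positivity
    simp only [Pi.div_apply]
    rw [(entries_eq_of_smul_I (g n)).1]
    field_simp
    ring
  refine ⟨g, hmem, hne, hcinv, ?_, ?_, hd⟩
  · have h := hr.add (hs.mul hd)
    rw [zero_mul, add_zero] at h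
    refine h.congr' ?_
    filter_upwards [hne] with n hn
    rw [(entries_eq_of_smul_I (g n)).1]
    field_simp
  · have h := (hr.mul hd).sub hs
    rw [sub_zero, mul_neg, ← sq] at h
    refine h.congr' ?_
    filter_upwards [hne] with n hn
    rw [(entries_eq_of_smul_I (g n)).2.1]
    field_simp

/-- A discrete subgroup `Γ ≤ SL(2,ℝ)` whose limit set contains at least 3 points
(non-elementary) contains a loxodromic element, i.e. some `h ∈ Γ` with `|tr h| > 2`. -/
theorem exists_loxodromic_of_nonelementary
    (Γ : Subgroup (Matrix.SpecialLinearGroup (Fin 2) ℝ))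
    (hdisc : IsDiscreteSubgroup Γ)
    (hnonelem : ∃ a b c : ℂ, a ∈ limitSet Γ ∧ b ∈ limitSet Γ ∧ c ∈ limitSet Γ ∧
      a ≠ b ∧ a ≠ c ∧ b ≠ c) :
    ∃ h ∈ Γ, |Matrix.trace ((h : Matrix.SpecialLinearGroup (Fin 2) ℝ) :
      Matrix (Fin 2) (Fin 2) ℝ)| > 2 := by
  by_contra! htr
  obtain ⟨x, y, -, hx, hy, -, hxy, -, -⟩ := hnonelem
  obtain ⟨g, hg, hgne, hgc, hga, hgb, hgd⟩ := exists_seq_tendsto_nilpotent hdisc htr hx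
  obtain ⟨h, hh, hhne, hhc, hha, hhb, hhd⟩ := exists_seq_tendsto_nilpotent hdisc htr hy
  have hzero : Filter.Tendsto (fun n => Matrix.trace ((g n * h n :
      Matrix.SpecialLinearGroup (Fin 2) ℝ) : Matrix (Fin 2) (Fin 2) ℝ) *
      ((g n 1 0)⁻¹ * (h n 1 0)⁻¹)) Filter.atTop (nhds 0) := by
    refine bdd_le_mul_tendsto_zero' 2
      (Filter.Eventually.of_forall fun n => htr _ (Γ.mul_mem (hg n) (hh n))) ?_
    simpa using hgc.mul hhc
  have hlim := (((hga.mul hha).add hgb).add hhb).add (hgd.mul hhd)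
  have heq := tendsto_nhds_unique hzero (hlim.congr' (by
    filter_upwards [hgne, hhne] with n hgn hhn
    simp only [Matrix.SpecialLinearGroup.coe_mul, Matrix.trace_fin_two, Matrix.mul_apply,
      Fin.sum_univ_two]
    field_simp
    ring))
  have hre : x.re = y.re := by
    have : (x.re - y.re) ^ 2 = 0 := by linarith
    exact sub_eq_zero.1 (pow_eq_zero_iff two_ne_zero |>.1 this)
  exact hxy (Complex.ext hre (by
    rw [im_eq_zero_of_mem_limitSet_s8 hdisc hx, im_eq_zero_of_mem_limitSet_s8 hdisc hy]))
end

section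
/- Let Γ be a discrete subgroup of SL(2,ℝ) acting on the upper half-plane ℍ, and let h ∈ Γ with |tr h| > 2. Then both fixed points of the Möbius action of h on ℝ (the real solutions p of γp² + (δ − α)p − β = 0, where h = [[α, β], [γ, δ]]) belong to the limit set L(Γ). -/
open UpperHalfPlane Metric

open Matrix in
/-- If `(p, 1)` is an eigenvector of `g ∈ SL(2,ℝ)` with eigenvalue `μ`, then `g • i` is within
`(1 + p²) / μ²` of `p`. -/
lemma norm_smul_I_sub_le {g : SpecialLinearGroup (Fin 2) ℝ} {p μ : ℝ} (hμ : μ ≠ 0)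
    (hg : (g : Matrix (Fin 2) (Fin 2) ℝ) *ᵥ ![p, 1] = μ • ![p, 1]) :
    ‖((g • UpperHalfPlane.I : UpperHalfPlane) : ℂ) - p‖ ≤ (1 + p ^ 2) / μ ^ 2 := by
  have h0 := congrFun hg 0
  have h1 := congrFun hg 1
  have hdet := g.det_coe
  rw [det_fin_two] at hdet
  simp only [mulVec, dotProduct, Fin.sum_univ_two, cons_val_zero, cons_val_one, Pi.smul_apply,
    smul_eq_mul, mul_one] at h0 h1
  rw [UpperHalfPlane.specialLinearGroup_apply]
  simp only [UpperHalfPlane.coe_I, Algebra.algebraMap_self, RingHom.id_apply]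
  generalize (g : Matrix (Fin 2) (Fin 2) ℝ) 0 0 = a at *
  generalize (g : Matrix (Fin 2) (Fin 2) ℝ) 0 1 = b at *
  generalize (g : Matrix (Fin 2) (Fin 2) ℝ) 1 0 = c at *
  generalize (g : Matrix (Fin 2) (Fin 2) ℝ) 1 1 = d at *
  have hcs : μ ^ 2 ≤ (c ^ 2 + d ^ 2) * (1 + p ^ 2) := by
    rw [← h1]; nlinarith [sq_nonneg (c - d * p)]
  have hμ2 : 0 < μ ^ 2 := by positivity
  have hcd : 0 < c ^ 2 + d ^ 2 := by
    by_contra! hle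
    nlinarith [sq_nonneg p]
  have hz : (c * Complex.I + d : ℂ) ≠ 0 := fun hz => by
    have hre := congrArg Complex.re hz
    have him := congrArg Complex.im hz
    simp at hre him
    simp [hre, him] at hcd
  have key : ((a * Complex.I + b) / (c * Complex.I + d) - p : ℂ)
      = (Complex.I - p) / ((c * Complex.I + d) * μ) := by
    have hμc : (μ : ℂ) ≠ 0 := by exact_mod_cast hμ
    have e0 : (a * p + b : ℂ) = μ * p := by exact_mod_cast h0
    have e1 : (c * p + d : ℂ) = μ := by exact_mod_cast h1
    have e2 : (a * d - b * c : ℂ) = 1 := by exact_mod_cast hdet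
    rw [div_sub' hz, div_eq_div_iff hz (mul_ne_zero hz hμc)]
    have ha : ((a - c * p) * μ : ℂ) = 1 := by linear_combination e2 - a * e1 + c * e0
    linear_combination (c * Complex.I + d) * ((Complex.I - p) * ha + μ * (e0 - p * e1))
  rw [key]
  refine abs_le_of_sq_le_sq' ?_ (by positivity) |>.2
  rw [norm_div, norm_mul, div_pow, mul_pow, ← Complex.normSq_eq_norm_sq,
    ← Complex.normSq_eq_norm_sq, ← Complex.normSq_eq_norm_sq]
  simp only [Complex.normSq_apply, Complex.sub_re, Complex.I_re, Complex.ofReal_re, Complex.sub_im,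
    Complex.I_im, Complex.ofReal_im, Complex.add_re, Complex.mul_re, Complex.add_im, Complex.mul_im]
  rw [div_pow, div_le_div_iff₀ (by ring_nf; nlinarith [mul_pos hcd hμ2]) (by positivity)]
  nlinarith [mul_le_mul_of_nonneg_left hcs (by positivity : 0 ≤ (1 + p ^ 2) * μ ^ 2)]

open Matrix in
lemma pow_mulVec_eq_of_mulVec_eq {n R : Type*} [Fintype n] [DecidableEq n] [CommRing R]
    {A : Matrix n n R} {v : n → R} {μ : R} (h : A *ᵥ v = μ • v) (k : ℕ) :
    (A ^ k) *ᵥ v = μ ^ k • v := by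
  induction k with
  | zero => simp
  | succ k ih => rw [pow_succ, ← mulVec_mulVec, h, mulVec_smul, ih, smul_smul, ← pow_succ']

open Matrix in
/-- A real point represented by an expanded eigenvector of an element of `Γ` is a limit of the
orbit of `i`. -/
lemma mem_closure_orbitOfI {Γ : Subgroup (SpecialLinearGroup (Fin 2) ℝ)}
    {g : SpecialLinearGroup (Fin 2) ℝ} (hgΓ : g ∈ Γ) {p μ : ℝ} (hμ : 1 < |μ|)
    (hg : (g : Matrix (Fin 2) (Fin 2) ℝ) *ᵥ ![p, 1] = μ • ![p, 1]) :
    (p : ℂ) ∈ closure (orbitOfI Γ) := by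
  have hμ0 : μ ≠ 0 := by rintro rfl; norm_num at hμ
  have hbound (n : ℕ) : ‖(((g ^ n) • UpperHalfPlane.I : UpperHalfPlane) : ℂ) - p‖
      ≤ (1 + p ^ 2) * ((μ ^ 2)⁻¹) ^ n := by
    refine (norm_smul_I_sub_le (pow_ne_zero n hμ0) ?_).trans_eq ?_
    · exact pow_mulVec_eq_of_mulVec_eq hg n
    · rw [inv_pow, ← div_eq_mul_inv, ← pow_mul, ← pow_mul, mul_comm]
  refine mem_closure_of_tendsto (b := Filter.atTop)
    (f := fun n : ℕ => (((g ^ n) • UpperHalfPlane.I : UpperHalfPlane) : ℂ)) ?_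
    (.of_forall fun n => ⟨⟨g ^ n, pow_mem hgΓ n⟩, rfl⟩)
  rw [tendsto_iff_norm_sub_tendsto_zero]
  refine squeeze_zero (fun _ => norm_nonneg _) hbound ?_
  rw [← mul_zero (1 + p ^ 2)]
  refine (tendsto_pow_atTop_nhds_zero_of_lt_one (by positivity) ?_).const_mul _
  exact inv_lt_one_of_one_lt₀ ((one_lt_sq_iff_one_lt_abs μ).2 hμ)

/-- If `Γ ≤ SL(2,ℝ)` is discrete and `h ∈ Γ` is loxodromic (`|tr h| > 2`) then every real fixed
point of the Möbius action of `h = [[α,β],[γ,δ]]` (i.e. every real root of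
`γp² + (δ−α)p − β = 0`) lies in the limit set `L(Γ)`. -/
theorem fixed_points_of_loxodromic_mem_limitSet
    (Γ : Subgroup (Matrix.SpecialLinearGroup (Fin 2) ℝ))
    (hdisc : IsDiscreteSubgroup Γ)
    (h : Matrix.SpecialLinearGroup (Fin 2) ℝ) (hh : h ∈ Γ)
    (hlox : |Matrix.trace (h : Matrix (Fin 2) (Fin 2) ℝ)| > 2) :
    ∀ p : ℝ, (h : Matrix (Fin 2) (Fin 2) ℝ) 1 0 * p ^ 2 +
      ((h : Matrix (Fin 2) (Fin 2) ℝ) 1 1 - (h : Matrix (Fin 2) (Fin 2) ℝ) 0 0) * p -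
      (h : Matrix (Fin 2) (Fin 2) ℝ) 0 1 = 0 →
      (p : ℂ) ∈ limitSet Γ := by
  intro p hp
  refine ⟨?_, ?_⟩
  swap
  · rintro ⟨g, hg⟩
    have him := congrArg Complex.im hg
    rw [Complex.ofReal_im] at him
    exact (UpperHalfPlane.im_pos _).ne' him
  have hdet := h.det_coe
  rw [Matrix.det_fin_two] at hdet
  rw [Matrix.trace_fin_two] at hlox
  set μ := (h : Matrix (Fin 2) (Fin 2) ℝ) 1 0 * p + (h : Matrix (Fin 2) (Fin 2) ℝ) 1 1 with hμ
  have hchar : μ * ((h : Matrix (Fin 2) (Fin 2) ℝ) 0 0 +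
      (h : Matrix (Fin 2) (Fin 2) ℝ) 1 1 - μ) = 1 := by
    rw [hμ]
    linear_combination hdet - (h : Matrix (Fin 2) (Fin 2) ℝ) 1 0 * hp
  have hμ0 : μ ≠ 0 := left_ne_zero_of_mul_eq_one hchar
  have heig : Matrix.mulVec (h : Matrix (Fin 2) (Fin 2) ℝ) ![p, 1] = μ • ![p, 1] := by
    ext i
    fin_cases i
    · simp [Matrix.mulVec, dotProduct, Fin.sum_univ_two]
      linear_combination -hp
    · simp [Matrix.mulVec, dotProduct, Fin.sum_univ_two, hμ]
  rcases lt_trichotomy |μ| 1 with hlt | heq | hgt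
  · refine mem_closure_orbitOfI (inv_mem hh) (μ := μ⁻¹) ?_ ?_
    · rw [abs_inv]
      exact (one_lt_inv₀ (abs_pos.2 hμ0)).2 hlt
    · have hinv : ((h⁻¹ : Matrix.SpecialLinearGroup (Fin 2) ℝ) : Matrix (Fin 2) (Fin 2) ℝ) *
          (h : Matrix (Fin 2) (Fin 2) ℝ) = 1 := by
        rw [← Matrix.SpecialLinearGroup.coe_mul, inv_mul_cancel, Matrix.SpecialLinearGroup.coe_one]
      rw [eq_inv_smul_iff₀ hμ0, ← Matrix.mulVec_smul, ← heig, Matrix.mulVec_mulVec, hinv,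
        Matrix.one_mulVec]
  · rcases eq_or_eq_neg_of_abs_eq heq with h1 | h1 <;> rw [h1] at hchar
    · rw [show (h : Matrix (Fin 2) (Fin 2) ℝ) 0 0 + (h : Matrix (Fin 2) (Fin 2) ℝ) 1 1 = 2 by
        linarith] at hlox
      norm_num at hlox
    · rw [show (h : Matrix (Fin 2) (Fin 2) ℝ) 0 0 + (h : Matrix (Fin 2) (Fin 2) ℝ) 1 1 = -2 by
        linarith] at hlox
      norm_num at hlox
  · exact mem_closure_orbitOfI hh hgt heig
end
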